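/- Let G be a finitely presented group with H_1(G,ℤ) = 0 and H_2(G,ℤ) = 0, and suppose there is an element g ∈ G whose image has infinite order in every non-trivial quotient of G (i.e., for every surjective homomorphism φ : G → Q with Q ≠ 1, the element φ(g) has infinite order). Then d(Gⁿ) ≤ d(G) + 1 for all n ≥ 1, and there is a positive constant C such that for every n ≥ 2 the group Gⁿ admits a presentation with at most d(G) + 1 generators and at most C·log n relators. -/

import Mathlib

/-- `Γ` has a presentation with `k` generators and at most `l` relators:
a surjection from the free group of rank `k` whose kernel is the normal
closure of a set of at most `l` elements. -/
def HasPresentationCard (Γ : Type*) [Group Γ] (k l : ℕ) : Prop :=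
  ∃ φ : FreeGroup (Fin k) →* Γ, Function.Surjective φ ∧
    ∃ R : Set (FreeGroup (Fin k)), R.Finite ∧ R.ncard ≤ l ∧
      φ.ker = Subgroup.normalClosure R

/-- `Γ` is finitely presented. -/
def FinitelyPresented (Γ : Type*) [Group Γ] : Prop :=
  ∃ k l, HasPresentationCard Γ k l

/-- `d(Γ)`: the minimal cardinality of a (finite) generating set of `Γ`. -/
noncomputable def dGen (Γ : Type*) [Group Γ] : ℕ :=
  sInf {d | ∃ S : Set Γ, S.Finite ∧ S.ncard = d ∧ Subgroup.closure S = ⊤}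

/-- `ρ(Γ)`: the minimal number of relators among all finite presentations of `Γ`. -/
noncomputable def rho (Γ : Type*) [Group Γ] : ℕ :=
  sInf {l | ∃ k, HasPresentationCard Γ k l}

/-- The kernel `R` of the canonical presentation of `G` by the free group on
the underlying set of `G`. -/
abbrev freeKernel (G : Type*) [Group G] : Subgroup (FreeGroup G) :=
  (FreeGroup.lift (id : G → G)).ker

/-- `H₂(G,ℤ)`, presented via Hopf's formula `H₂(G,ℤ) ≅ (R ⊓ [F,F]) / [F,R]`
applied to the canonical free presentation `1 → R → F → G → 1` with `F` the
free group on the underlying set of `G`. -/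
abbrev H2 (G : Type*) [Group G] : Type _ :=
  ↥(freeKernel G ⊓ commutator (FreeGroup G)) ⧸
    (⁅(⊤ : Subgroup (FreeGroup G)), freeKernel G⁆.subgroupOf
      (freeKernel G ⊓ commutator (FreeGroup G)))

universe u

open scoped commutatorElement

/-- Every perfect central extension of `P` is trivial. -/
def SPGrp (P : Type*) [Group P] : Prop :=
  commutator P = ⊤ ∧ ∀ (E : Type) [Group E] (π : E →* P), Function.Surjective π →
    π.ker ≤ Subgroup.center E → commutator E = ⊤ → Function.Injective π

/-- Presentation on a generating type `α` with at most `l` relators. -/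
def PresOn (Γ : Type*) [Group Γ] (α : Type) (l : ℕ) : Prop :=
  ∃ φ : FreeGroup α →* Γ, Function.Surjective φ ∧
    ∃ R : Set (FreeGroup α), R.Finite ∧ R.ncard ≤ l ∧
      φ.ker = Subgroup.normalClosure R

lemma comm_le_of_central {E : Type*} [Group E] (K H : Subgroup E)
    (h : ∀ e ∈ K, ∃ x ∈ H, ∃ z ∈ Subgroup.center E, e = x * z) : ⁅K, K⁆ ≤ ⁅H, H⁆ := by
  rw [Subgroup.commutator_le]
  intro a ha b hb
  obtain ⟨x, hx, z, hz, rfl⟩ := h a ha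
  obtain ⟨y, hy, w, hw, rfl⟩ := h b hb
  have hz' := Subgroup.mem_center_iff.1 hz
  have hw' := Subgroup.mem_center_iff.1 hw
  have : ⁅x * z, y * w⁆ = ⁅x, y⁆ := by
    simp only [commutatorElement_def, mul_inv_rev]
    calc x * z * (y * w) * (z⁻¹ * x⁻¹) * (w⁻¹ * y⁻¹)
        = x * (z * (y * w)) * z⁻¹ * x⁻¹ * (w⁻¹ * y⁻¹) := by group
      _ = x * ((y * w) * z) * z⁻¹ * x⁻¹ * (w⁻¹ * y⁻¹) := by rw [hz']
      _ = x * y * (w * x⁻¹) * w⁻¹ * y⁻¹ := by group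
      _ = x * y * (x⁻¹ * w) * w⁻¹ * y⁻¹ := by rw [hw']
      _ = _ := by group
  rw [this]
  exact Subgroup.commutator_mem_commutator hx hy

lemma SPGrp.sub {P : Type*} [Group P] (hP : SPGrp P) {E : Type} [Group E] (f : E →* P)
    (D : Subgroup E) (hD : D ≤ ⁅D, D⁆) (hs : D.map f = ⊤)
    (hc : ∀ x ∈ D, f x = 1 → x ∈ Subgroup.center E) : ∀ x ∈ D, f x = 1 → x = 1 := by
  have inj := hP.2 D (f.comp D.subtype) (by
      intro p
      have : p ∈ D.map f := by rw [hs]; trivial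
      obtain ⟨x, hx, rfl⟩ := this
      exact ⟨⟨x, hx⟩, rfl⟩) (by
      rintro ⟨x, hx⟩ h
      have := hc x hx h
      rw [Subgroup.mem_center_iff] at this ⊢
      intro y
      exact Subtype.ext (this y)) (by
      apply Subgroup.map_injective D.subtype_injective
      rw [Subgroup.map_subtype_commutator]
      rw [← MonoidHom.range_eq_map, Subgroup.range_subtype]
      exact le_antisymm (Subgroup.commutator_le_self D) hD)
  intro x hx h
  have : (⟨x, hx⟩ : D) = 1 := inj (by simpa using h)
  simpa using this

lemma SPGrp.prod {P Q : Type*} [Group P] [Group Q] (hP : SPGrp P) (hQ : SPGrp Q) :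
    SPGrp (P × Q) := by
  constructor
  · have h := Subgroup.commutator_prod_prod (⊤ : Subgroup P) ⊤ (⊤ : Subgroup Q) ⊤
    rw [Subgroup.top_prod_top] at h
    rw [commutator_def, h, ← commutator_def, ← commutator_def, hP.1, hQ.1,
      Subgroup.top_prod_top]
  intro E _ π hs hk hE
  set f1 : E →* P := (MonoidHom.fst P Q).comp π with hf1
  set f2 : E →* Q := (MonoidHom.snd P Q).comp π with hf2
  have hcen : ∀ x, f1 x = 1 → f2 x = 1 → x ∈ Subgroup.center E := by
    intro x h1 h2
    exact hk (Prod.ext h1 h2)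
  have m1 : Subgroup.map f1 f2.ker = ⊤ := by
    rw [eq_top_iff]
    intro p _
    obtain ⟨x, hx⟩ := hs (p, 1)
    exact ⟨x, by simp [hf2, MonoidHom.mem_ker, hx], by simp [hf1, hx]⟩
  have m2 : Subgroup.map f2 f1.ker = ⊤ := by
    rw [eq_top_iff]
    intro p _
    obtain ⟨x, hx⟩ := hs (1, p)
    exact ⟨x, by simp [hf1, MonoidHom.mem_ker, hx], by simp [hf2, hx]⟩
  set D1 := ⁅f2.ker, f2.ker⁆ with hD1
  set D2 := ⁅f1.ker, f1.ker⁆ with hD2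
  have d1 : D1.map f1 = ⊤ := by
    rw [hD1, Subgroup.map_commutator, m1, ← commutator_def, hP.1]
  have d2 : D2.map f2 = ⊤ := by
    rw [hD2, Subgroup.map_commutator, m2, ← commutator_def, hQ.1]
  have l1 : D1 ≤ f2.ker := Subgroup.commutator_le_self _
  have l2 : D2 ≤ f1.ker := Subgroup.commutator_le_self _
  have e1 : ∀ x ∈ D1, f1 x = 1 → x = 1 := by
    apply hP.sub f1 D1 _ d1
    · intro x hx h
      exact hcen x h (l1 hx)
    · apply comm_le_of_central
      intro e he
      have : f1 e ∈ D1.map f1 := by rw [d1]; trivial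
      obtain ⟨x, hx, hxe⟩ := this
      refine ⟨x, hx, x⁻¹ * e, hcen _ ?_ ?_, by group⟩
      · simp [hxe]
      · rw [map_mul, map_inv, l1 hx, he]; simp
  have e2 : ∀ x ∈ D2, f2 x = 1 → x = 1 := by
    apply hQ.sub f2 D2 _ d2
    · intro x hx h
      exact hcen x (l2 hx) h
    · apply comm_le_of_central
      intro e he
      have : f2 e ∈ D2.map f2 := by rw [d2]; trivial
      obtain ⟨x, hx, hxe⟩ := this
      refine ⟨x, hx, x⁻¹ * e, hcen _ ?_ ?_, by group⟩
      · rw [map_mul, map_inv, l2 hx, he]; simp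
      · simp [hxe]
  have all : ∀ e : E, e ∈ D1 ⊔ D2 := by
    intro e
    have h1 : e ∈ ⁅(⊤ : Subgroup E), (⊤ : Subgroup E)⁆ := by rw [← commutator_def, hE]; trivial
    have h2 : ⁅(⊤ : Subgroup E), ⊤⁆ ≤ ⁅D1 ⊔ D2, D1 ⊔ D2⁆ := by
      apply comm_le_of_central
      intro a _
      have : f1 a ∈ D1.map f1 := by rw [d1]; trivial
      obtain ⟨x, hx, hxe⟩ := this
      have : f2 a ∈ D2.map f2 := by rw [d2]; trivial
      obtain ⟨y, hy, hye⟩ := this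
      refine ⟨x * y, Subgroup.mul_mem_sup hx hy, (x * y)⁻¹ * a, hcen _ ?_ ?_, by group⟩
      · rw [map_mul, map_inv, map_mul, hxe, l2 hy]; simp
      · rw [map_mul, map_inv, map_mul, hye, l1 hx]; simp
    exact Subgroup.commutator_le_self (D1 ⊔ D2) (h2 h1)
  rw [injective_iff_map_eq_one]
  intro e he
  have : D1.Normal := by rw [hD1]; infer_instance
  obtain ⟨x, hx, y, hy, rfl⟩ := Subgroup.mem_sup_of_normal_left.1 (all e)
  have g1 : f1 (x * y) = 1 := by simp only [hf1, MonoidHom.comp_apply, he]; rfl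
  have g2 : f2 (x * y) = 1 := by simp only [hf2, MonoidHom.comp_apply, he]; rfl
  rw [map_mul, l2 hy, mul_one] at g1
  rw [map_mul, l1 hx, one_mul] at g2
  rw [e1 x hx g1, e2 y hy g2, one_mul]

lemma SPGrp.congr {P Q : Type*} [Group P] [Group Q] (hP : SPGrp P) (e : P ≃* Q) : SPGrp Q := by
  constructor
  · rw [eq_top_iff, ← Subgroup.map_top_of_surjective e.toMonoidHom e.surjective, ← hP.1,
      commutator_def, Subgroup.map_commutator]
    exact Subgroup.commutator_mono le_top le_top
  · intro E _ π hs hk hE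
    have := hP.2 E (e.symm.toMonoidHom.comp π) (e.symm.surjective.comp hs) (by
      intro x hx
      apply hk
      have : e.symm (π x) = 1 := hx
      simpa [MonoidHom.mem_ker] using this) hE
    exact Function.Injective.of_comp (f := e.symm) this

lemma SPGrp.ofHopf (G : Type*) [Group G]
    (hH1 : Subsingleton (Abelianization G)) (hH2 : Subsingleton (H2 G)) : SPGrp G := by
  constructor
  · rw [eq_top_iff]
    intro x _
    have : (Abelianization.of x) = 1 := Subsingleton.elim _ _
    rwa [← MonoidHom.mem_ker, Abelianization.ker_of] at this
  intro E _ π hs hk hE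
  obtain ⟨s, hs'⟩ := hs.hasRightInverse
  set f : FreeGroup G →* E := FreeGroup.lift s with hf
  have hπf : π.comp f = FreeGroup.lift (id : G → G) := by
    ext x; simp [hf, hs' x]
  have hπf' : ∀ w, π (f w) = FreeGroup.lift (id : G → G) w := fun w => DFunLike.congr_fun hπf w
  rw [injective_iff_map_eq_one]
  intro e he
  have h1 : e ∈ ⁅(⊤ : Subgroup E), (⊤ : Subgroup E)⁆ := by rw [← commutator_def, hE]; trivial
  have h2 : ⁅(⊤ : Subgroup E), ⊤⁆ ≤ ⁅f.range, f.range⁆ := by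
    apply comm_le_of_central
    intro a _
    refine ⟨f (FreeGroup.of (π a)), ⟨_, rfl⟩, (f (FreeGroup.of (π a)))⁻¹ * a, hk ?_, by group⟩
    rw [MonoidHom.mem_ker, map_mul, map_inv, hπf']; simp
  have h3 := h2 h1
  rw [MonoidHom.range_eq_map, ← Subgroup.map_commutator, ← commutator_def] at h3
  obtain ⟨w, hw, rfl⟩ := h3
  have hwR : w ∈ freeKernel G := by
    rw [MonoidHom.mem_ker, ← hπf', he]
  have hw2 : w ∈ freeKernel G ⊓ commutator (FreeGroup G) := ⟨hwR, hw⟩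
  have h4 : w ∈ ⁅(⊤ : Subgroup (FreeGroup G)), freeKernel G⁆ := by
    have : (QuotientGroup.mk (⟨w, hw2⟩ : ↥(freeKernel G ⊓ commutator (FreeGroup G))) : H2 G)
      = QuotientGroup.mk 1 := Subsingleton.elim _ _
    rw [QuotientGroup.eq] at this
    have := Subgroup.mem_subgroupOf.1 this
    simpa using this
  have h5 : ⁅(⊤ : Subgroup (FreeGroup G)), freeKernel G⁆ ≤ f.ker := by
    rw [Subgroup.commutator_le]
    intro a _ b hb
    have : f b ∈ Subgroup.center E := hk (by rw [MonoidHom.mem_ker, hπf']; exact hb)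
    rw [MonoidHom.mem_ker, map_commutatorElement, commutatorElement_eq_one_iff_mul_comm]
    exact Subgroup.mem_center_iff.1 this _
  exact h5 h4

/-! ### Presentations -/

lemma free_lift_exists {α : Type} {A B : Type*} [Group A] [Group B] (p : A →* B)
    (hp : Function.Surjective p) (φ : FreeGroup α →* B) :
    ∃ f : FreeGroup α →* A, ∀ w, p (f w) = φ w := by
  choose s hs using hp
  refine ⟨FreeGroup.lift fun a => s (φ (FreeGroup.of a)), fun w => ?_⟩
  have : p.comp (FreeGroup.lift fun a => s (φ (FreeGroup.of a))) = φ := by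
    ext x; simp [hs]
  exact DFunLike.congr_fun this w

lemma PresOn.change {Γ : Type*} [Group Γ] {α : Type} {l k : ℕ} (h : PresOn Γ α l)
    (ψ : FreeGroup (Fin k) →* Γ) (hψ : Function.Surjective ψ) : PresOn Γ (Fin k) (l + k) := by
  obtain ⟨φ, hφ, R, hR, hl, hk⟩ := h
  obtain ⟨f, hf⟩ := free_lift_exists ψ hψ φ
  obtain ⟨u, hu⟩ := free_lift_exists φ hφ ψ
  set T : Set (FreeGroup (Fin k)) :=
    Set.range fun i : Fin k => (FreeGroup.of i)⁻¹ * f (u (FreeGroup.of i)) with hT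
  refine ⟨ψ, hψ, f '' R ∪ T, (hR.image f).union (Set.finite_range _), ?_, ?_⟩
  · refine (Set.ncard_union_le _ _).trans (add_le_add ((Set.ncard_image_le hR).trans hl) ?_)
    have := Set.ncard_image_le (f := fun i : Fin k => (FreeGroup.of i)⁻¹ * f (u (FreeGroup.of i)))
      (Set.finite_univ)
    rw [Set.image_univ, Set.ncard_univ, Nat.card_fin] at this
    exact this
  set N := Subgroup.normalClosure (f '' R ∪ T) with hN
  apply le_antisymm
  · intro w hw
    have h1 : (QuotientGroup.mk' N).comp (f.comp u) = QuotientGroup.mk' N := by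
      ext i
      simp only [MonoidHom.comp_apply, QuotientGroup.mk'_apply]
      symm
      rw [QuotientGroup.eq]
      exact Subgroup.subset_normalClosure (Or.inr ⟨i, rfl⟩)
    have h2 : Subgroup.normalClosure R ≤ N.comap f := by
      apply Subgroup.normalClosure_le_normal
      intro r hr
      exact Subgroup.subset_normalClosure (Or.inl ⟨r, hr, rfl⟩)
    have h3 : u w ∈ φ.ker := by rw [MonoidHom.mem_ker, hu]; exact hw
    rw [hk] at h3
    have h4 : f (u w) ∈ N := h2 h3
    have h5 := DFunLike.congr_fun h1 w
    simp only [MonoidHom.comp_apply, QuotientGroup.mk'_apply] at h5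
    rw [QuotientGroup.eq] at h5
    have := N.mul_mem h4 h5
    simpa using this
  · apply Subgroup.normalClosure_le_normal
    rintro _ (⟨r, hr, rfl⟩ | ⟨i, rfl⟩)
    · show ψ _ = 1
      rw [hf]
      have : r ∈ φ.ker := by rw [hk]; exact Subgroup.subset_normalClosure hr
      exact this
    · show ψ _ = 1
      rw [map_mul, map_inv, hf, hu]; simp

lemma PresOn.congr {Γ Δ : Type*} [Group Γ] [Group Δ] {α : Type} {l : ℕ} (h : PresOn Γ α l)
    (e : Γ ≃* Δ) : PresOn Δ α l := by
  obtain ⟨φ, hφ, R, hR, hl, hk⟩ := h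
  refine ⟨e.toMonoidHom.comp φ, e.surjective.comp hφ, R, hR, hl, ?_⟩
  rw [← hk]
  ext x
  simp [MonoidHom.mem_ker]

section prodpres

variable {α β : Type}

/-- first inclusion -/
def fin1 : FreeGroup α →* FreeGroup (α ⊕ β) := FreeGroup.map Sum.inl
/-- second inclusion -/
def fin2 : FreeGroup β →* FreeGroup (α ⊕ β) := FreeGroup.map Sum.inr

/-- commutation relators -/
def commRel (α β : Type) : Set (FreeGroup (α ⊕ β)) :=
  Set.range fun p : α × β => ⁅(FreeGroup.of (Sum.inl p.1) : FreeGroup (α ⊕ β)), FreeGroup.of (Sum.inr p.2)⁆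

lemma commRel_finite [Finite α] [Finite β] : (commRel α β).Finite := Set.finite_range _

lemma commRel_card [Finite α] [Finite β] : (commRel α β).ncard ≤ Nat.card α * Nat.card β := by
  have := Set.ncard_image_le (f := fun p : α × β =>
    ⁅(FreeGroup.of (Sum.inl p.1) : FreeGroup (α ⊕ β)),
      (FreeGroup.of (Sum.inr p.2) : FreeGroup (α ⊕ β))⁆)
      (Set.finite_univ)
  rw [Set.image_univ, Set.ncard_univ, Nat.card_prod] at this
  exact this

lemma comm_of_commRel {E : Type*} [Group E] (q : FreeGroup (α ⊕ β) →* E)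
    (hq : ∀ r ∈ commRel α β, q r = 1) (w : FreeGroup α) (v : FreeGroup β) :
    Commute (q (fin1 w)) (q (fin2 v)) := by
  have base : ∀ a b, Commute (q (FreeGroup.of (Sum.inl a))) (q (FreeGroup.of (Sum.inr b))) := by
    intro a b
    have := hq _ ⟨(a, b), rfl⟩
    simp only [map_commutatorElement] at this
    exact commutatorElement_eq_one_iff_commute.1 this
  induction w using FreeGroup.induction_on with
  | C1 => simp
  | of a =>
    induction v using FreeGroup.induction_on with
    | C1 => simp
    | of b => simpa [fin1, fin2] using base a b
    | inv_of b h => rw [map_inv, map_inv]; exact h.inv_right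
    | mul x y hx hy => rw [map_mul, map_mul]; exact hx.mul_right hy
  | inv_of a h => rw [map_inv, map_inv]; exact h.inv_left
  | mul x y hx hy => rw [map_mul, map_mul]; exact hx.mul_left hy

lemma split_of_commRel {E : Type*} [Group E] (q : FreeGroup (α ⊕ β) →* E)
    (hq : ∀ r ∈ commRel α β, q r = 1) (w : FreeGroup (α ⊕ β)) :
    ∃ a b, q w = q (fin1 a) * q (fin2 b) := by
  induction w using FreeGroup.induction_on with
  | C1 => exact ⟨1, 1, by simp⟩
  | of a =>
    rcases a with a | b
    · exact ⟨FreeGroup.of a, 1, by simp [fin1]⟩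
    · exact ⟨1, FreeGroup.of b, by simp [fin2]⟩
  | inv_of a h =>
    rcases a with a | b
    · exact ⟨(FreeGroup.of a)⁻¹, 1, by simp [fin1]⟩
    · exact ⟨1, (FreeGroup.of b)⁻¹, by simp [fin2]⟩
  | mul x y hx hy =>
    obtain ⟨a, b, h⟩ := hx
    obtain ⟨c, d, h'⟩ := hy
    refine ⟨a * c, b * d, ?_⟩
    have := comm_of_commRel q hq c b
    simp only [map_mul, h, h']
    rw [mul_assoc, ← mul_assoc (q (fin2 b)), ← this.eq]
    simp only [mul_assoc]

/-- the map of the free group to the product -/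
def prodMap {K L : Type*} [Group K] [Group L] (φ : FreeGroup α →* K) (θ : FreeGroup β →* L) :
    FreeGroup (α ⊕ β) →* K × L :=
  FreeGroup.lift (Sum.elim (fun a => (φ (FreeGroup.of a), 1)) (fun b => (1, θ (FreeGroup.of b))))

lemma prodMap_fin1 {K L : Type*} [Group K] [Group L] (φ : FreeGroup α →* K)
    (θ : FreeGroup β →* L) (w : FreeGroup α) : prodMap φ θ (fin1 w) = (φ w, 1) := by
  have : (prodMap φ θ).comp fin1 = (MonoidHom.inl K L).comp φ := by
    apply FreeGroup.ext_hom; intro x; simp [prodMap, fin1]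
  exact DFunLike.congr_fun this w

lemma prodMap_fin2 {K L : Type*} [Group K] [Group L] (φ : FreeGroup α →* K)
    (θ : FreeGroup β →* L) (w : FreeGroup β) : prodMap φ θ (fin2 w) = (1, θ w) := by
  have : (prodMap φ θ).comp fin2 = (MonoidHom.inr K L).comp θ := by
    apply FreeGroup.ext_hom; intro x; simp [prodMap, fin2]
  exact DFunLike.congr_fun this w

lemma prodMap_surj {K L : Type*} [Group K] [Group L] (φ : FreeGroup α →* K)
    (θ : FreeGroup β →* L) (h1 : Function.Surjective φ) (h2 : Function.Surjective θ) :
    Function.Surjective (prodMap φ θ) := by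
  rintro ⟨x, y⟩
  obtain ⟨a, rfl⟩ := h1 x
  obtain ⟨b, rfl⟩ := h2 y
  exact ⟨fin1 a * fin2 b, by rw [map_mul, prodMap_fin1, prodMap_fin2]; simp⟩

lemma prodMap_commRel {K L : Type*} [Group K] [Group L] (φ : FreeGroup α →* K)
    (θ : FreeGroup β →* L) : ∀ r ∈ commRel α β, prodMap φ θ r = 1 := by
  rintro _ ⟨⟨a, b⟩, rfl⟩
  simp [prodMap, commutatorElement_def]

lemma PresOn.prod {K L : Type*} [Group K] [Group L] [Finite α] [Finite β] {l m : ℕ}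
    (hK : PresOn K α l) (hL : PresOn L β m) :
    PresOn (K × L) (α ⊕ β) (l + m + Nat.card α * Nat.card β) := by
  obtain ⟨φ, hφ, R, hR, hl, hk⟩ := hK
  obtain ⟨θ, hθ, S, hS, hm, hk'⟩ := hL
  set T := fin1 '' R ∪ fin2 '' S ∪ commRel α β with hT
  refine ⟨prodMap φ θ, prodMap_surj φ θ hφ hθ, T,
    ((hR.image _).union (hS.image _)).union commRel_finite, ?_, ?_⟩
  · refine (Set.ncard_union_le _ _).trans (add_le_add ((Set.ncard_union_le _ _).trans
      (add_le_add ((Set.ncard_image_le hR).trans hl) ((Set.ncard_image_le hS).trans hm)))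
      commRel_card)
  set N := Subgroup.normalClosure T with hN
  have hTN : ∀ t ∈ T, QuotientGroup.mk' N t = 1 := by
    intro t ht
    rw [QuotientGroup.mk'_apply, QuotientGroup.eq_one_iff]
    exact Subgroup.subset_normalClosure ht
  apply le_antisymm
  · intro w hw
    obtain ⟨a, b, hab⟩ := split_of_commRel (QuotientGroup.mk' N)
      (fun r hr => hTN r (Or.inr hr)) w
    have hle : N ≤ (prodMap φ θ).ker := by
      apply Subgroup.normalClosure_le_normal
      rintro _ ((⟨r, hr, rfl⟩ | ⟨r, hr, rfl⟩) | hr)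
      · show prodMap φ θ _ = 1
        rw [prodMap_fin1]
        have : r ∈ φ.ker := by rw [hk]; exact Subgroup.subset_normalClosure hr
        rw [this]; rfl
      · show prodMap φ θ _ = 1
        rw [prodMap_fin2]
        have : r ∈ θ.ker := by rw [hk']; exact Subgroup.subset_normalClosure hr
        rw [this]; rfl
      · exact prodMap_commRel φ θ _ hr
    have h0 : prodMap φ θ (fin1 a * fin2 b) = 1 := by
      rw [← map_mul, QuotientGroup.mk'_apply, QuotientGroup.mk'_apply, QuotientGroup.eq] at hab
      have := hle hab
      rw [MonoidHom.mem_ker, map_mul, map_inv, (hw : prodMap φ θ w = 1)] at this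
      simpa using this
    rw [map_mul, prodMap_fin1, prodMap_fin2] at h0
    simp only [Prod.mk_mul_mk, mul_one, one_mul, Prod.mk_eq_one] at h0
    have ha : a ∈ Subgroup.normalClosure R := by rw [← hk]; exact h0.1
    have hb : b ∈ Subgroup.normalClosure S := by rw [← hk']; exact h0.2
    have h2 : Subgroup.normalClosure R ≤ N.comap fin1 := by
      apply Subgroup.normalClosure_le_normal
      intro r hr
      exact Subgroup.subset_normalClosure (Or.inl (Or.inl ⟨r, hr, rfl⟩))
    have h3 : Subgroup.normalClosure S ≤ N.comap fin2 := by
      apply Subgroup.normalClosure_le_normal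
      intro r hr
      exact Subgroup.subset_normalClosure (Or.inl (Or.inr ⟨r, hr, rfl⟩))
    rw [← map_mul, QuotientGroup.mk'_apply, QuotientGroup.mk'_apply, QuotientGroup.eq] at hab
    have := N.mul_mem (N.mul_mem (h2 ha) (h3 hb)) (N.inv_mem hab)
    simpa [mul_assoc] using this
  · apply Subgroup.normalClosure_le_normal
    rintro _ ((⟨r, hr, rfl⟩ | ⟨r, hr, rfl⟩) | hr)
    · show prodMap φ θ _ = 1
      rw [prodMap_fin1]
      have : r ∈ φ.ker := by rw [hk]; exact Subgroup.subset_normalClosure hr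
      rw [this]; rfl
    · show prodMap φ θ _ = 1
      rw [prodMap_fin2]
      have : r ∈ θ.ker := by rw [hk']; exact Subgroup.subset_normalClosure hr
      rw [this]; rfl
    · exact prodMap_commRel φ θ _ hr

lemma PresOn.double {K : Type*} [Group K] [Finite α] {l : ℕ} (hSP : SPGrp K)
    (hK : PresOn K α l) :
    PresOn (K × K) (α ⊕ α) (l + Nat.card α + Nat.card α * Nat.card α) := by
  obtain ⟨φ, hφ, R, hR, hl, hk⟩ := hK
  have hcomm : ∀ x : K, ∃ w ∈ commutator (FreeGroup α), φ w = x := by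
    intro x
    have : x ∈ (commutator (FreeGroup α)).map φ := by
      rw [commutator_def, Subgroup.map_commutator, Subgroup.map_top_of_surjective φ hφ,
        ← commutator_def, hSP.1]
      trivial
    exact this
  choose c hc hcφ using hcomm
  -- the diagonal map
  set δ : FreeGroup α →* FreeGroup (α ⊕ α) :=
    FreeGroup.lift fun a => FreeGroup.of (Sum.inl a) * FreeGroup.of (Sum.inr a) with hδ
  set U : Set (FreeGroup (α ⊕ α)) := Set.range fun a : α =>
    fin2 ((FreeGroup.of a)⁻¹ * c (φ (FreeGroup.of a))) with hU
  set T := δ '' R ∪ U ∪ commRel α α with hT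
  have hUfin : U.Finite := Set.finite_range _
  have hUcard : U.ncard ≤ Nat.card α := by
    have := Set.ncard_image_le (f := fun a : α =>
      (fin2 ((FreeGroup.of a)⁻¹ * c (φ (FreeGroup.of a))) : FreeGroup (α ⊕ α)))
      (Set.finite_univ)
    rw [Set.image_univ, Set.ncard_univ] at this
    exact this
  refine ⟨prodMap φ φ, prodMap_surj φ φ hφ hφ, T,
    ((hR.image _).union hUfin).union commRel_finite, ?_, ?_⟩
  · refine (Set.ncard_union_le _ _).trans (add_le_add ((Set.ncard_union_le _ _).trans
      (add_le_add ((Set.ncard_image_le hR).trans hl) hUcard)) commRel_card)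
  have hδφ : ∀ w, prodMap φ φ (δ w) = (φ w, φ w) := by
    intro w
    have : (prodMap φ φ).comp δ = φ.prod φ := by
      apply FreeGroup.ext_hom; intro x; simp [prodMap, hδ]
    exact DFunLike.congr_fun this w
  have hle : Subgroup.normalClosure T ≤ (prodMap φ φ).ker := by
    apply Subgroup.normalClosure_le_normal
    rintro _ ((⟨r, hr, rfl⟩ | ⟨a, rfl⟩) | hr)
    · show prodMap φ φ _ = 1
      rw [hδφ]
      have : r ∈ φ.ker := by rw [hk]; exact Subgroup.subset_normalClosure hr
      rw [this]; rfl
    · show prodMap φ φ _ = 1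
      simp only [prodMap_fin2, map_mul, map_inv, hcφ]
      simp
    · exact prodMap_commRel φ φ _ hr
  refine le_antisymm ?_ hle
  set N := Subgroup.normalClosure T with hN
  set q := QuotientGroup.mk' N with hq
  have hqs : Function.Surjective q := QuotientGroup.mk'_surjective N
  have hTN : ∀ t ∈ T, q t = 1 := by
    intro t ht
    rw [hq, QuotientGroup.mk'_apply, QuotientGroup.eq_one_iff]
    exact Subgroup.subset_normalClosure ht
  have hcr : ∀ r ∈ commRel α α, q r = 1 := fun r hr => hTN r (Or.inr hr)
  have hco := comm_of_commRel q hcr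
  have hsp := split_of_commRel q hcr
  have hδ' : ∀ w, q (δ w) = q (fin1 w) * q (fin2 w) := by
    intro w
    induction w using FreeGroup.induction_on with
    | C1 => simp
    | of a => simp [hδ, fin1, fin2]
    | inv_of a h =>
      rw [map_inv, map_inv, h, mul_inv_rev, map_inv, map_inv, map_inv, map_inv]
      exact ((hco _ _).inv_inv).eq.symm
    | mul x y hx hy =>
      simp only [map_mul, hx, hy]
      rw [mul_assoc, ← mul_assoc (q (fin2 x)), ← (hco y x).eq]
      simp only [mul_assoc]
  have hδk : ∀ w, φ w = 1 → q (δ w) = 1 := by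
    intro w hw
    have h2 : Subgroup.normalClosure R ≤ (q.comp δ).ker := by
      apply Subgroup.normalClosure_le_normal
      intro r hr
      exact hTN _ (Or.inl (Or.inl ⟨r, hr, rfl⟩))
    rw [← hk] at h2
    exact h2 hw
  have hcen1 : ∀ w, φ w = 1 → q (fin1 w) ∈ Subgroup.center (FreeGroup (α ⊕ α) ⧸ N) := by
    intro w hw
    rw [Subgroup.mem_center_iff]
    intro x
    obtain ⟨x, rfl⟩ := hqs x
    obtain ⟨a, b, hab⟩ := hsp x
    have h := hδk w hw
    rw [hδ'] at h
    have h' := eq_inv_of_mul_eq_one_left h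
    have c1 : Commute (q (fin1 w)) (q (fin1 a)) := by
      rw [h']; exact ((hco a w).symm).inv_left
    rw [hab]
    exact ((c1.mul_right (hco w b)).eq).symm
  have hcen2 : ∀ w, φ w = 1 → q (fin2 w) ∈ Subgroup.center (FreeGroup (α ⊕ α) ⧸ N) := by
    intro w hw
    have h := hδk w hw
    rw [hδ'] at h
    rw [eq_inv_of_mul_eq_one_right h]
    exact Subgroup.inv_mem _ (hcen1 w hw)
  set π : FreeGroup (α ⊕ α) ⧸ N →* K × K := QuotientGroup.lift N (prodMap φ φ) hle with hπ
  have hπq : ∀ w, π (q w) = prodMap φ φ w := fun w => rfl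
  have mapc : ∀ (f : FreeGroup α →* FreeGroup (α ⊕ α) ⧸ N), ∀ w ∈ commutator (FreeGroup α),
      f w ∈ commutator (FreeGroup (α ⊕ α) ⧸ N) := by
    intro f w hw
    have : f w ∈ (commutator (FreeGroup α)).map f := ⟨w, hw, rfl⟩
    rw [commutator_def, Subgroup.map_commutator] at this
    exact Subgroup.commutator_mono le_top le_top this
  have p2 : ∀ w, q (fin2 w) ∈ commutator (FreeGroup (α ⊕ α) ⧸ N) := by
    intro w
    induction w using FreeGroup.induction_on with
    | C1 => simp
    | of a =>
      have h := hTN _ (Or.inl (Or.inr ⟨a, rfl⟩))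
      simp only [map_mul, map_inv] at h
      rw [eq_of_inv_mul_eq_one h]
      exact mapc (q.comp fin2) _ (hc _)
    | inv_of a h => rw [map_inv, map_inv]; exact Subgroup.inv_mem _ h
    | mul x y hx hy => rw [map_mul, map_mul]; exact Subgroup.mul_mem _ hx hy
  have pδ : ∀ w, q (δ w) ∈ commutator (FreeGroup (α ⊕ α) ⧸ N) := by
    intro w
    have h := hδk ((c (φ w))⁻¹ * w) (by rw [map_mul, map_inv, hcφ]; simp)
    simp only [map_mul, map_inv] at h
    rw [← eq_of_inv_mul_eq_one h]
    exact mapc (q.comp δ) _ (hc _)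
  have p1 : ∀ w, q (fin1 w) ∈ commutator (FreeGroup (α ⊕ α) ⧸ N) := by
    intro w
    have : q (fin1 w) = q (δ w) * (q (fin2 w))⁻¹ := by rw [hδ']; group
    rw [this]
    exact Subgroup.mul_mem _ (pδ w) (Subgroup.inv_mem _ (p2 w))
  have hinj := (hSP.prod hSP).2 (FreeGroup (α ⊕ α) ⧸ N) π (by
      intro x
      obtain ⟨w, hw⟩ := prodMap_surj φ φ hφ hφ x
      exact ⟨q w, hw⟩) (by
      intro x hx
      obtain ⟨x, rfl⟩ := hqs x
      obtain ⟨a, b, hab⟩ := hsp x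
      rw [MonoidHom.mem_ker, hab, map_mul, hπq, hπq, prodMap_fin1, prodMap_fin2] at hx
      simp only [Prod.mk_mul_mk, mul_one, one_mul, Prod.mk_eq_one] at hx
      rw [hab]
      exact Subgroup.mul_mem _ (hcen1 a hx.1) (hcen2 b hx.2)) (by
      rw [eq_top_iff]
      intro x _
      obtain ⟨x, rfl⟩ := hqs x
      obtain ⟨a, b, hab⟩ := hsp x
      rw [hab]
      exact Subgroup.mul_mem _ (p1 a) (p2 b))
  intro w hw
  have h0 : q w = 1 := hinj (by rw [hπq, map_one]; exact hw)
  rwa [hq, QuotientGroup.mk'_apply, QuotientGroup.eq_one_iff] at h0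

end prodpres

/-! ### Generation -/

/-- In a perfect group, a normal-ish argument: the subgroup surjecting onto all pairs is everything. -/
lemma single_mem {G : Type*} [Group G] (hG : commutator G = ⊤) {ι : Type*} [DecidableEq ι]
    (H : Subgroup (ι → G)) (i : ι)
    (hp : ∀ j, j ≠ i → ∀ x : G, ∃ h ∈ H, h i = x ∧ h j = 1) (hd : ∀ x : G, ∃ h ∈ H, h i = x)
    (s : Finset ι) (hs : i ∉ s) :
    ∀ x : G, ∃ h ∈ H, h i = x ∧ ∀ j ∈ s, h j = 1 := by
  induction s using Finset.induction_on with
  | empty => intro x; obtain ⟨h, hh, e⟩ := hd x; exact ⟨h, hh, e, by simp⟩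
  | insert j s hj ih =>
    have ih := ih (fun h => hs (Finset.mem_insert_of_mem h))
    have hji : j ≠ i := fun h => hs (h ▸ Finset.mem_insert_self _ _)
    let D : Subgroup (ι → G) :=
      { carrier := {h | h ∈ H ∧ ∀ k ∈ insert j s, h k = 1}
        mul_mem' := by
          rintro a b ⟨ha, ha'⟩ ⟨hb, hb'⟩
          exact ⟨H.mul_mem ha hb, fun k hk => by simp [ha' k hk, hb' k hk]⟩
        one_mem' := ⟨H.one_mem, fun k _ => rfl⟩
        inv_mem' := by
          rintro a ⟨ha, ha'⟩
          exact ⟨H.inv_mem ha, fun k hk => by simp [ha' k hk]⟩ }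
    have key : ⁅(⊤ : Subgroup G), ⊤⁆ ≤ D.map (Pi.evalMonoidHom (fun _ : ι => G) i) := by
      rw [Subgroup.commutator_le]
      intro a _ b _
      obtain ⟨u, hu, hui, hus⟩ := ih a
      obtain ⟨v, hv, hvi, hvj⟩ := hp j hji b
      refine ⟨⁅u, v⁆, ⟨?_, ?_⟩, ?_⟩
      · simp only [commutatorElement_def]
        exact H.mul_mem (H.mul_mem (H.mul_mem hu hv) (H.inv_mem hu)) (H.inv_mem hv)
      · intro k hk
        rcases Finset.mem_insert.1 hk with rfl | hk
        · simp [commutatorElement_def, hvj]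
        · simp [commutatorElement_def, hus k hk]
      · simp [commutatorElement_def, hui, hvi]
    intro x
    have hx : x ∈ ⁅(⊤ : Subgroup G), (⊤ : Subgroup G)⁆ := by rw [← commutator_def, hG]; trivial
    obtain ⟨h, ⟨h1, h2⟩, h3⟩ := key hx
    exact ⟨h, h1, h3, h2⟩

lemma gen_pow {G : Type u} [Group G] (hG : commutator G = ⊤) (g : G)
    (hg : ∀ (Q : Type u) [Group Q] (φ : G →* Q), Function.Surjective φ →
      Nontrivial Q → ¬ IsOfFinOrder (φ g)) {d : ℕ} (a : Fin d → G)
    (ha : Subgroup.closure (Set.range a) = ⊤) (n : ℕ) :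
    ∃ b : Fin (d + 1) → (Fin n → G), Subgroup.closure (Set.range b) = ⊤ := by
  refine ⟨Fin.snoc (α := fun _ => Fin n → G) (fun k _ => a k) (fun i => g ^ (i : ℕ)), ?_⟩
  set b : Fin (d + 1) → (Fin n → G) :=
    Fin.snoc (α := fun _ => Fin n → G) (fun k _ => a k) (fun i => g ^ (i : ℕ)) with hb
  set H := Subgroup.closure (Set.range b) with hH
  have hdiag : ∀ x : G, (fun _ => x) ∈ H := by
    intro x
    have : (⊤ : Subgroup G) ≤ H.comap (Pi.constMonoidHom (Fin n) G) := by
      rw [← ha, Subgroup.closure_le]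
      rintro _ ⟨k, rfl⟩
      apply Subgroup.subset_closure
      exact ⟨k.castSucc, by simp [hb]; rfl⟩
    exact this (Subgroup.mem_top x)
  have ht : (fun i : Fin n => g ^ (i : ℕ)) ∈ H :=
    Subgroup.subset_closure ⟨Fin.last d, by simp [hb]⟩
  have hnc : ∀ m : ℤ, m ≠ 0 → Subgroup.normalClosure {g ^ m} = ⊤ := by
    intro m hm
    by_contra hne
    have hnt : Nontrivial (G ⧸ Subgroup.normalClosure {g ^ m}) := by
      rw [QuotientGroup.nontrivial_iff]; exact hne
    apply hg _ (QuotientGroup.mk' (Subgroup.normalClosure {g ^ m}))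
      (QuotientGroup.mk'_surjective _) hnt
    rw [isOfFinOrder_iff_zpow_eq_one]
    refine ⟨m, hm, ?_⟩
    rw [← map_zpow, QuotientGroup.mk'_apply, QuotientGroup.eq_one_iff]
    exact Subgroup.subset_normalClosure rfl
  have hpair : ∀ i j : Fin n, j ≠ i → ∀ x : G, ∃ h ∈ H, h i = x ∧ h j = 1 := by
    intro i j hji x
    let D : Subgroup G :=
      { carrier := {x | ∃ h ∈ H, h i = x ∧ h j = 1}
        mul_mem' := by
          rintro _ _ ⟨u, hu, rfl, hu'⟩ ⟨v, hv, rfl, hv'⟩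
          exact ⟨u * v, H.mul_mem hu hv, rfl, by simp [hu', hv']⟩
        one_mem' := ⟨1, H.one_mem, rfl, rfl⟩
        inv_mem' := by
          rintro _ ⟨u, hu, rfl, hu'⟩
          exact ⟨u⁻¹, H.inv_mem hu, rfl, by simp [hu']⟩ }
    have : D.Normal := by
      constructor
      rintro _ ⟨u, hu, rfl, hu'⟩ y
      exact ⟨(fun _ => y) * u * (fun _ => y)⁻¹,
        H.mul_mem (H.mul_mem (hdiag y) hu) (H.inv_mem (hdiag y)), rfl, by simp [hu']⟩
    have hle : Subgroup.normalClosure {g ^ ((i : ℤ) - (j : ℤ))} ≤ D := by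
      apply Subgroup.normalClosure_le_normal
      rintro _ rfl
      refine ⟨(fun i : Fin n => g ^ (i : ℕ)) * (fun _ => g ^ (j : ℕ))⁻¹,
        H.mul_mem ht (H.inv_mem (hdiag _)), ?_, ?_⟩
      · simp [zpow_sub]
      · simp
    rw [hnc _ (by
      intro h
      apply hji
      ext
      omega)] at hle
    exact hle (Subgroup.mem_top x)
  rw [eq_top_iff]
  intro f _
  have hsingle : ∀ i x, Pi.mulSingle i x ∈ H := by
    intro i x
    obtain ⟨h, hh, h1, h2⟩ := single_mem hG H i (hpair i)
      (fun x => ⟨_, hdiag x, rfl⟩) (Finset.univ.erase i) (by simp) x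
    convert hh
    ext j
    by_cases hj : j = i
    · subst hj; simp [h1]
    · rw [Pi.mulSingle_eq_of_ne hj, h2 j (by simp [hj])]
  have := Subgroup.pi_mem_of_mulSingle_mem (H := H) f (fun i => hsingle i (f i))
  exact this

lemma exists_gens {G : Type u} [Group G] (h : FinitelyPresented G) :
    ∃ a : Fin (dGen G) → G, Subgroup.closure (Set.range a) = ⊤ := by
  obtain ⟨k, l, φ, hφ, -⟩ := h
  have hne : {d | ∃ S : Set G, S.Finite ∧ S.ncard = d ∧ Subgroup.closure S = ⊤}.Nonempty := by
    refine ⟨_, Set.range fun i => φ (FreeGroup.of i), Set.finite_range _, rfl, ?_⟩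
    rw [eq_top_iff, ← Subgroup.map_top_of_surjective φ hφ, ← FreeGroup.closure_range_of,
      MonoidHom.map_closure, ← Set.range_comp]
    rfl
  obtain ⟨S, hS, hc, hcl⟩ := Nat.sInf_mem hne
  change S.ncard = dGen G at hc
  have := hS.to_subtype
  have e : S ≃ Fin (dGen G) := Finite.equivFinOfCardEq (by rw [← hc]; rfl)
  refine ⟨fun i => (e.symm i : G), ?_⟩
  have : Set.range (fun i => (e.symm i : G)) = S := by
    rw [show (fun i => (e.symm i : G)) = Subtype.val ∘ e.symm from rfl, Set.range_comp,
      e.symm.surjective.range_eq, Set.image_univ, Subtype.range_val]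
  rw [this, hcl]

/-- splitting a power -/
def powSplit (G : Type*) [Group G] (m n : ℕ) :
    (Fin m → G) × (Fin n → G) ≃* (Fin (m + n) → G) where
  toEquiv := Fin.appendEquiv m n
  map_mul' := by
    rintro ⟨a, b⟩ ⟨c, d⟩
    funext i
    refine Fin.addCases (fun i => ?_) (fun i => ?_) i <;> simp [Fin.appendEquiv]

/-- first power -/
def powOne (G : Type*) [Group G] : G ≃* (Fin 1 → G) where
  toEquiv := (Equiv.funUnique (Fin 1) G).symm
  map_mul' := fun a b => rfl

lemma SPGrp.pow {G : Type*} [Group G] (h : SPGrp G) (n : ℕ) : SPGrp (Fin (n + 1) → G) := by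
  induction n with
  | zero => exact h.congr (powOne G)
  | succ n ih => exact (ih.prod (h.congr (powOne G))).congr (powSplit G (n + 1) 1)

lemma pres_pow {G : Type u} [Group G] (hFP : FinitelyPresented G) (hSP : SPGrp G) (d : ℕ)
    (hgen : ∀ n : ℕ, ∃ b : Fin d → (Fin n → G), Subgroup.closure (Set.range b) = ⊤) :
    ∃ c : ℕ, ∀ n : ℕ, 1 ≤ n → PresOn (Fin n → G) (Fin d) (c * (1 + Nat.log 2 n)) := by
  have hsurj : ∀ n : ℕ, ∃ ψ : FreeGroup (Fin d) →* (Fin n → G), Function.Surjective ψ := by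
    intro n
    obtain ⟨b, hb⟩ := hgen n
    refine ⟨FreeGroup.lift b, ?_⟩
    rw [← MonoidHom.range_eq_top, FreeGroup.range_lift_eq_closure, hb]
  have mono : ∀ {Γ : Type u} [Group Γ] {α : Type} {l m : ℕ}, l ≤ m → PresOn Γ α l →
      PresOn Γ α m := by
    rintro Γ _ α l m hlm ⟨φ, hφ, R, hR, hl, hk⟩
    exact ⟨φ, hφ, R, hR, hl.trans hlm, hk⟩
  obtain ⟨k, l, hkl⟩ := hFP
  have base : PresOn (Fin 1 → G) (Fin d) (l + d) := by
    obtain ⟨ψ, hψ⟩ := hsurj 1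
    exact PresOn.change (PresOn.congr (hkl : PresOn G (Fin k) l) (powOne G)) ψ hψ
  set r := l + d with hr
  have dbl : ∀ n m : ℕ, PresOn (Fin (n + 1) → G) (Fin d) m →
      PresOn (Fin (n + 1 + (n + 1)) → G) (Fin d) (m + d + d * d + d) := by
    intro n m h
    obtain ⟨ψ, hψ⟩ := hsurj (n + 1 + (n + 1))
    have := (PresOn.double (hSP.pow n) h).congr (powSplit G (n + 1) (n + 1))
    rw [Nat.card_fin] at this
    exact this.change ψ hψ
  have add1 : ∀ n m : ℕ, PresOn (Fin n → G) (Fin d) m →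
      PresOn (Fin (n + 1) → G) (Fin d) (m + r + d * d + d) := by
    intro n m h
    obtain ⟨ψ, hψ⟩ := hsurj (n + 1)
    have := (PresOn.prod h base).congr (powSplit G n 1)
    rw [Nat.card_fin] at this
    exact this.change ψ hψ
  refine ⟨r + d + d * d + d + d * d + d, ?_⟩
  set c := r + d + d * d + d + d * d + d with hc
  intro n
  induction n using Nat.strong_induction_on with
  | _ n ih =>
    intro hn
    by_cases h1 : n = 1
    · subst h1
      exact mono (by simp [hc]; omega) base
    obtain ⟨m, hm⟩ : ∃ m, n / 2 = m + 1 := ⟨n / 2 - 1, by omega⟩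
    have hlog : Nat.log 2 n = Nat.log 2 (m + 1) + 1 := by
      rw [← hm, Nat.log_of_one_lt_of_le (by norm_num) (by omega)]
    have h2 := dbl m _ (ih (m + 1) (by omega) (by omega))
    rw [hlog]
    rcases Nat.even_or_odd' n with ⟨p, hp | hp⟩
    · have : n = m + 1 + (m + 1) := by omega
      subst this
      refine mono ?_ h2
      have e : c * (1 + (Nat.log 2 (m + 1) + 1)) = c * (1 + Nat.log 2 (m + 1)) + c := by ring
      rw [e]
      omega
    · have : n = m + 1 + (m + 1) + 1 := by omega
      subst this
      refine mono ?_ (add1 _ _ h2)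
      have e : c * (1 + (Nat.log 2 (m + 1) + 1)) = c * (1 + Nat.log 2 (m + 1)) + c := by ring
      rw [e]
      omega

/-- If `G` is finitely presented with `H₁(G,ℤ) = H₂(G,ℤ) = 0` and some `g ∈ G`
has infinite order in every non-trivial quotient of `G`, then `d(Gⁿ) ≤ d(G)+1`
and `Gⁿ` has a presentation with at most `d(G)+1` generators and `O(log n)`
relators. -/
theorem stmt_4 (G : Type u) [Group G] (hFP : FinitelyPresented G)
    (hH1 : Subsingleton (Abelianization G)) (hH2 : Subsingleton (H2 G))
    (g : G)
    (hg : ∀ (Q : Type u) [Group Q] (φ : G →* Q), Function.Surjective φ →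
      Nontrivial Q → ¬ IsOfFinOrder (φ g)) :
    (∀ n : ℕ, 1 ≤ n → dGen (Fin n → G) ≤ dGen G + 1) ∧
    ∃ C : ℝ, 0 < C ∧ ∀ n : ℕ, 2 ≤ n → ∃ k l : ℕ, k ≤ dGen G + 1 ∧
      (l : ℝ) ≤ C * Real.log n ∧ HasPresentationCard (Fin n → G) k l := by
  have hSP := SPGrp.ofHopf G hH1 hH2
  obtain ⟨a, ha⟩ := exists_gens hFP
  have hgen := gen_pow hSP.1 g hg a ha
  constructor
  · intro n _
    obtain ⟨b, hb⟩ := hgen n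
    have hmem : (Set.range b).ncard ∈ {d | ∃ S : Set (Fin n → G), S.Finite ∧ S.ncard = d ∧
        Subgroup.closure S = ⊤} := ⟨Set.range b, Set.finite_range _, rfl, hb⟩
    refine (Nat.sInf_le hmem).trans ?_
    have := Set.ncard_image_le (f := b) (Set.finite_univ)
    rw [Set.image_univ, Set.ncard_univ, Nat.card_fin] at this
    exact this
  obtain ⟨c, hc⟩ := pres_pow hFP hSP (dGen G + 1) hgen
  have h2 : 0 < Real.log 2 := Real.log_pos (by norm_num)
  refine ⟨(2 * c + 1) / Real.log 2, by positivity, ?_⟩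
  intro n hn
  refine ⟨dGen G + 1, c * (1 + Nat.log 2 n), le_rfl, ?_, hc n (by omega)⟩
  have hl1 : 1 ≤ Nat.log 2 n := Nat.log_pos (by norm_num) hn
  have hl2 : (Nat.log 2 n : ℝ) * Real.log 2 ≤ Real.log n := by
    rw [← Real.log_pow]
    apply Real.log_le_log (by positivity)
    exact_mod_cast Nat.pow_log_le_self 2 (by omega)
  rw [div_mul_eq_mul_div, le_div_iff₀ h2]
  push_cast
  have hl1' : (1 : ℝ) ≤ Nat.log 2 n := by exact_mod_cast hl1
  have hc0 : (0 : ℝ) ≤ c := by positivity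
  have hln : 0 ≤ Real.log n := le_trans (by positivity) hl2
  calc (c : ℝ) * (1 + Nat.log 2 n) * Real.log 2
      ≤ c * (Nat.log 2 n + Nat.log 2 n) * Real.log 2 := by gcongr
    _ = 2 * c * (Nat.log 2 n * Real.log 2) := by ring
    _ ≤ 2 * c * Real.log n := by gcongr
    _ ≤ (2 * c + 1) * Real.log n := by nlinarith
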